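/- For every φ ∈ L_BAPAL, the formula □φ → □□φ is valid with respect to the L_BAPAL semantics. -/

import Mathlib

/-- Boolean (propositional) formulas over atoms `P`. -/
inductive PLForm (P : Type) : Type
  | atom : P → PLForm P
  | neg : PLForm P → PLForm P
  | and : PLForm P → PLForm P → PLForm P

/-- The language L_BAPAL over agents `A` and atoms `P`. -/
inductive Form (A P : Type) : Type
  | atom : P → Form A P
  | neg : Form A P → Form A P
  | and : Form A P → Form A P → Form A P
  | know : A → Form A P → Form A P
  | ann : Form A P → Form A P → Form A P
  | box : Form A P → Form A P

def PLForm.toForm {A P : Type} : PLForm P → Form A P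
  | .atom p => .atom p
  | .neg φ => .neg φ.toForm
  | .and φ ψ => .and φ.toForm ψ.toForm

structure Model (A P : Type) where
  S : Type
  rel : A → S → S → Prop
  val : P → S → Prop

/-- An epistemic model: each accessibility relation is an equivalence relation. -/
def Model.IsEpistemic {A P : Type} (M : Model A P) : Prop :=
  ∀ a : A, Equivalence (M.rel a)

/-- Restriction of a model to a subset of its states. -/
def Model.restrict {A P : Type} (M : Model A P) (X : Set M.S) : Model A P where
  S := X
  rel a s t := M.rel a s.val t.val
  val p s := M.val p s.val

/-- Satisfaction of boolean formulas. -/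
def SatPL {A P : Type} (M : Model A P) (s : M.S) : PLForm P → Prop
  | .atom p => M.val p s
  | .neg φ => ¬ SatPL M s φ
  | .and φ ψ => SatPL M s φ ∧ SatPL M s ψ

/-- BAPAL satisfaction. -/
def Sat {A P : Type} : (M : Model A P) → M.S → Form A P → Prop
  | M, s, .atom p => M.val p s
  | M, s, .neg φ => ¬ Sat M s φ
  | M, s, .and φ ψ => Sat M s φ ∧ Sat M s ψ
  | M, s, .know a φ => ∀ t : M.S, M.rel a s t → Sat M t φ
  | M, s, .ann φ ψ => ∀ h : Sat M s φ, Sat (M.restrict {t | Sat M t φ}) ⟨s, h⟩ ψ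
  | M, s, .box ψ => ∀ (φ₀ : PLForm P) (h : SatPL M s φ₀),
      Sat (M.restrict {t | SatPL M t φ₀}) ⟨s, h⟩ ψ

def Valid {A P : Type} (φ : Form A P) : Prop :=
  ∀ M : Model A P, M.IsEpistemic → ∀ s : M.S, Sat M s φ

def Form.imp {A P : Type} (φ ψ : Form A P) : Form A P := .neg (.and φ (.neg ψ))
def Form.iff {A P : Type} (φ ψ : Form A P) : Form A P := .and (φ.imp ψ) (ψ.imp φ)
def Form.dia {A P : Type} (φ : Form A P) : Form A P := .neg (.box (.neg φ))
def Form.khat {A P : Type} (a : A) (φ : Form A P) : Form A P := .neg (.know a (.neg φ))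
def Form.diaAnn {A P : Type} (φ ψ : Form A P) : Form A P := .neg (.ann φ (.neg ψ))

def Form.occurs {A P : Type} (q : P) : Form A P → Prop
  | .atom p => p = q
  | .neg φ => φ.occurs q
  | .and φ ψ => φ.occurs q ∨ ψ.occurs q
  | .know _ φ => φ.occurs q
  | .ann φ ψ => φ.occurs q ∨ ψ.occurs q
  | .box φ => φ.occurs q

def Form.mapAtoms {A P Q : Type} (f : P → Q) : Form A P → Form A Q
  | .atom p => .atom (f p)
  | .neg φ => .neg (φ.mapAtoms f)
  | .and φ ψ => .and (φ.mapAtoms f) (ψ.mapAtoms f)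
  | .know a φ => .know a (φ.mapAtoms f)
  | .ann φ ψ => .ann (φ.mapAtoms f) (ψ.mapAtoms f)
  | .box φ => .box (φ.mapAtoms f)

/-- An isomorphism of models. -/
structure Model.Iso {A P : Type} (M N : Model A P) where
  toEquiv : M.S ≃ N.S
  rel_iff : ∀ a s t, M.rel a s t ↔ N.rel a (toEquiv s) (toEquiv t)
  val_iff : ∀ p s, M.val p s ↔ N.val p (toEquiv s)

/-- An isomorphism restricts to subsets that correspond under it. -/
def Model.Iso.restrict {A P : Type} {M N : Model A P} (e : M.Iso N) (X : Set M.S) (Y : Set N.S)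
    (h : ∀ s, s ∈ X ↔ e.toEquiv s ∈ Y) : (M.restrict X).Iso (N.restrict Y) where
  toEquiv := e.toEquiv.subtypeEquiv h
  rel_iff a s t := e.rel_iff a s.val t.val
  val_iff p s := e.val_iff p s.val

/-- Restricting twice amounts to restricting once to the intersection. -/
def Model.restrictRestrictIso {A P : Type} (M : Model A P) (X Z : Set M.S)
    (Y : Set (M.restrict X).S) (h : ∀ s, s ∈ Z ↔ ∃ hs : s ∈ X, (⟨s, hs⟩ : (M.restrict X).S) ∈ Y) :
    (M.restrict Z).Iso ((M.restrict X).restrict Y) where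
  toEquiv :=
    { toFun := fun s => ⟨⟨s.1, ((h s.1).1 s.2).fst⟩, ((h s.1).1 s.2).snd⟩
      invFun := fun s => ⟨s.1.1, (h s.1.1).2 ⟨s.1.2, s.2⟩⟩
      left_inv := fun _ => rfl
      right_inv := fun _ => rfl }
  rel_iff _ _ _ := Iff.rfl
  val_iff _ _ := Iff.rfl

theorem satPL_iso {A P : Type} {M N : Model A P} (e : M.Iso N) (s : M.S) (φ : PLForm P) :
    SatPL M s φ ↔ SatPL N (e.toEquiv s) φ := by
  induction φ with
  | atom p => exact e.val_iff p s
  | neg φ ih => exact not_congr ih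
  | and φ ψ ih₁ ih₂ => exact and_congr ih₁ ih₂

theorem satPL_restrict {A P : Type} (M : Model A P) (X : Set M.S) (s : (M.restrict X).S)
    (φ : PLForm P) : SatPL (M.restrict X) s φ ↔ SatPL M s.val φ := by
  induction φ with
  | atom p => exact Iff.rfl
  | neg φ ih => exact not_congr ih
  | and φ ψ ih₁ ih₂ => exact and_congr ih₁ ih₂

/-- Satisfaction is invariant under isomorphism. -/
theorem sat_iso {A P : Type} (φ : Form A P) {M N : Model A P} (e : M.Iso N) (s : M.S) :
    Sat M s φ ↔ Sat N (e.toEquiv s) φ := by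
  induction φ generalizing M N with
  | atom p => exact e.val_iff p s
  | neg φ ih => exact not_congr (ih e s)
  | and φ ψ ih₁ ih₂ => exact and_congr (ih₁ e s) (ih₂ e s)
  | know a φ ih =>
    simp only [Sat]
    rw [← e.toEquiv.forall_congr_right]
    exact forall_congr' fun t => imp_congr (e.rel_iff a s t) (ih e t)
  | ann φ ψ ih₁ ih₂ =>
    simp only [Sat]
    have key (h : Sat M s φ) :=
      ih₂ (e.restrict {t | Sat M t φ} {t | Sat N t φ} fun t => ih₁ e t) ⟨s, h⟩
    exact ⟨fun H h => (key ((ih₁ e s).2 h)).1 (H _), fun H h => (key h).2 (H _)⟩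
  | box ψ ih =>
    simp only [Sat]
    refine forall_congr' fun φ₀ => ?_
    have key (h : SatPL M s φ₀) :=
      ih (e.restrict {t | SatPL M t φ₀} {t | SatPL N t φ₀} fun t => satPL_iso e t φ₀) ⟨s, h⟩
    exact ⟨fun H h => (key ((satPL_iso e s φ₀).2 h)).1 (H _), fun H h => (key h).2 (H _)⟩

/-- `□φ → □□φ` is valid. -/
theorem box_imp_boxbox_valid {A : Type} [Countable A] (φ : Form A ℕ) :
    Valid (Form.imp (.box φ) (.box (.box φ))) := by
  intro M _ s
  simp only [Form.imp, Sat]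
  rintro ⟨hbox, hn⟩
  refine hn fun φ₀ h₀ φ₁ h₁ => ?_
  have h₁' := (satPL_restrict M _ _ φ₁).1 h₁
  exact (sat_iso φ (M.restrictRestrictIso {t | SatPL M t φ₀} {t | SatPL M t (.and φ₀ φ₁)}
    {t | SatPL (M.restrict {t | SatPL M t φ₀}) t φ₁} fun t =>
      ⟨fun h => ⟨h.1, (satPL_restrict M _ _ φ₁).2 h.2⟩,
        fun ⟨h, h'⟩ => ⟨h, (satPL_restrict M _ _ φ₁).1 h'⟩⟩) ⟨s, h₀, h₁'⟩).1
    (hbox (.and φ₀ φ₁) ⟨h₀, h₁'⟩)
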